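/- Suppose β ≤ 0.4 and Conditions 1, 2 and 3 hold. Let B' ⊆ B satisfy |B' ∩ B_G| ≥ (1 − β/6)|B_G|, let S ⊆ [k], and suppose ψ(B', S) = t·κ_G for some t ≥ 0. Then |p̄_{B'}(S) − p(S)| ≤ (5 + √(2.1·t))·β·√(ln(6e/β)/n). -/

import Mathlib

open Finset

noncomputable def emp {m n k : ℕ} (X : Fin m → Fin n → Fin k)
    (b : Fin m) (S : Finset (Fin k)) : ℝ :=
  (∑ i : Fin n, if X b i ∈ S then (1 : ℝ) else 0) / (n : ℝ)

noncomputable def pbar {m n k : ℕ} (X : Fin m → Fin n → Fin k)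
    (B' : Finset (Fin m)) (S : Finset (Fin k)) : ℝ :=
  (∑ b ∈ B', emp X b S) / (B'.card : ℝ)

noncomputable def probS {k : ℕ} (p : Fin k → ℝ) (S : Finset (Fin k)) : ℝ :=
  ∑ i ∈ S, p i

noncomputable def Vf (n : ℕ) (r : ℝ) : ℝ := r * (1 - r) / (n : ℝ)

noncomputable def medOf {m n k : ℕ} (X : Fin m → Fin n → Fin k)
    (S : Finset (Fin k)) : ℝ :=
  ((Finset.univ.val.map fun b : Fin m => emp X b S).sort (· ≤ ·)).getD (m / 2) 0

noncomputable def score {m n k : ℕ} (β : ℝ) (X : Fin m → Fin n → Fin k)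
    (b : Fin m) (S : Finset (Fin k)) : ℝ :=
  if |emp X b S - medOf X S| ≤ 3 * Real.sqrt (Real.log (6 * Real.exp 1 / β) / (n : ℝ))
  then 0 else (emp X b S - medOf X S) ^ 2

noncomputable def psi {m n k : ℕ} (β : ℝ) (X : Fin m → Fin n → Fin k)
    (B' : Finset (Fin m)) (S : Finset (Fin k)) : ℝ :=
  ∑ b ∈ B', score β X b S

noncomputable def psiMax {m n k : ℕ} (β : ℝ) (X : Fin m → Fin n → Fin k)
    (B' : Finset (Fin m)) : ℝ :=
  Finset.univ.sup' Finset.univ_nonempty fun S : Finset (Fin k) => psi β X B' S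

noncomputable def Vbar {m n k : ℕ} (X : Fin m → Fin n → Fin k)
    (B' : Finset (Fin m)) (S : Finset (Fin k)) : ℝ :=
  (∑ b ∈ B', (emp X b S - pbar X B' S) ^ 2) / (B'.card : ℝ)

noncomputable def kappaG (β : ℝ) (m n : ℕ) : ℝ :=
  β * (m : ℝ) * Real.log (6 * Real.exp 1 / β) / (n : ℝ)

def Cond1 {m n k : ℕ} (X : Fin m → Fin n → Fin k) (p : Fin k → ℝ) : Prop :=
  ∀ S : Finset (Fin k), |medOf X S - probS p S| ≤ Real.sqrt (Real.log 6 / (n : ℝ))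

def Cond2 {m n k : ℕ} (β : ℝ) (X : Fin m → Fin n → Fin k) (p : Fin k → ℝ)
    (BG : Finset (Fin m)) : Prop :=
  ∀ S : Finset (Fin k), ∀ B'G ⊆ BG, (1 - β / 6) * (BG.card : ℝ) ≤ (B'G.card : ℝ) →
    |pbar X B'G S - probS p S| ≤
      (β / 2) * Real.sqrt (Real.log (6 * Real.exp 1 / β) / (n : ℝ)) ∧
    |(∑ b ∈ B'G, (emp X b S - probS p S) ^ 2) / (B'G.card : ℝ) - Vf n (probS p S)| ≤
      6 * β * Real.log (6 * Real.exp 1 / β) / (n : ℝ)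

def Cond3 {m n k : ℕ} (β : ℝ) (X : Fin m → Fin n → Fin k)
    (BG : Finset (Fin m)) : Prop :=
  ∀ S : Finset (Fin k), psi β X BG S ≤ kappaG β m n

lemma score_nonneg {m n k : ℕ} (β : ℝ) (X : Fin m → Fin n → Fin k)
    (b : Fin m) (S : Finset (Fin k)) : 0 ≤ score β X b S := by
  unfold score
  split_ifs <;> positivity

lemma abs_emp_sub_medOf_le {m n k : ℕ} (β : ℝ) (X : Fin m → Fin n → Fin k)
    (b : Fin m) (S : Finset (Fin k)) :
    |emp X b S - medOf X S| ≤
      3 * Real.sqrt (Real.log (6 * Real.exp 1 / β) / (n : ℝ)) + Real.sqrt (score β X b S) := by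
  unfold score
  split_ifs with h
  · simpa using h
  · rw [Real.sqrt_sq_eq_abs]
    linarith [Real.sqrt_nonneg (Real.log (6 * Real.exp 1 / β) / (n : ℝ))]

lemma log_six_le_log_div {β : ℝ} (hβ0 : 0 < β) (hβ1 : β ≤ 1) :
    Real.log 6 ≤ Real.log (6 * Real.exp 1 / β) := by
  apply Real.log_le_log (by norm_num)
  rw [le_div_iff₀ hβ0]
  linarith [Real.add_one_le_exp 1]

lemma sum_sqrt_score_sq_le {m n k : ℕ} (β : ℝ) (X : Fin m → Fin n → Fin k)
    (B' A : Finset (Fin m)) (hA : A ⊆ B') (S : Finset (Fin k)) :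
    (∑ b ∈ A, Real.sqrt (score β X b S)) ^ 2 ≤ (A.card : ℝ) * psi β X B' S := by
  refine sq_sum_le_card_mul_sum_sq.trans ?_
  gcongr
  calc ∑ b ∈ A, Real.sqrt (score β X b S) ^ 2 = ∑ b ∈ A, score β X b S :=
        Finset.sum_congr rfl fun b _ => Real.sq_sqrt (score_nonneg β X b S)
    _ ≤ psi β X B' S :=
        Finset.sum_le_sum_of_subset_of_nonneg hA fun b _ _ => score_nonneg β X b S

lemma abs_sum_emp_sub_le {m n k : ℕ} {β : ℝ} (hβ0 : 0 < β) (hβ1 : β ≤ 1)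
    (X : Fin m → Fin n → Fin k) (p : Fin k → ℝ) (h1 : Cond1 X p)
    (A : Finset (Fin m)) (S : Finset (Fin k)) :
    |∑ b ∈ A, (emp X b S - probS p S)| ≤
      4 * (A.card : ℝ) * Real.sqrt (Real.log (6 * Real.exp 1 / β) / (n : ℝ)) +
        ∑ b ∈ A, Real.sqrt (score β X b S) := by
  have hmed : |medOf X S - probS p S| ≤
      Real.sqrt (Real.log (6 * Real.exp 1 / β) / (n : ℝ)) := by
    refine (h1 S).trans (Real.sqrt_le_sqrt ?_)
    have := log_six_le_log_div hβ0 hβ1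
    gcongr
  calc |∑ b ∈ A, (emp X b S - probS p S)| ≤ ∑ b ∈ A, |emp X b S - probS p S| :=
        Finset.abs_sum_le_sum_abs _ _
    _ ≤ ∑ b ∈ A, (4 * Real.sqrt (Real.log (6 * Real.exp 1 / β) / (n : ℝ)) +
          Real.sqrt (score β X b S)) := by
        refine Finset.sum_le_sum fun b _ => ?_
        linarith [abs_sub_le (emp X b S) (medOf X S) (probS p S),
          abs_emp_sub_medOf_le β X b S]
    _ = _ := by
        rw [Finset.sum_add_distrib, Finset.sum_const, nsmul_eq_mul]
        ring

lemma good_card_linear_bound {β g a M : ℝ} (hβ0 : 0 < β) (hβ : β ≤ 0.4) (hM : 0 ≤ M)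
    (ha : a ≤ β * M) (hg : (1 - β / 6) * (1 - β) * M ≤ g) :
    g * (β / 2) + 4 * a ≤ 5 * β * (g + a) := by
  norm_num at hβ
  have h1 : a * (4 - 5 * β) ≤ β * M * (4 - 5 * β) :=
    mul_le_mul_of_nonneg_right ha (by linarith)
  have h2 : β * ((1 - β / 6) * (1 - β) * M) ≤ β * g := mul_le_mul_of_nonneg_left hg hβ0.le
  have h3 : 0 ≤ β * M * (0.5 - 0.25 * β + 0.75 * β ^ 2) :=
    mul_nonneg (mul_nonneg hβ0.le hM) (by nlinarith)
  linarith

lemma bad_card_mul_le {β g a M : ℝ} (hβ0 : 0 < β) (hβ : β ≤ 0.4) (hM : 0 ≤ M)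
    (ha0 : 0 ≤ a) (ha : a ≤ β * M) (hg : (1 - β / 6) * (1 - β) * M ≤ g) :
    a * M ≤ 2.1 * β * (g + a) ^ 2 := by
  norm_num at hβ
  obtain ⟨c, hc⟩ : ∃ c, c = (1 - β / 6) * (1 - β) := ⟨_, rfl⟩
  rw [← hc] at hg
  have hcβ : β ≤ c := by nlinarith
  have hc1 : 0.95 ≤ β + c := by nlinarith
  have hcM : 0 ≤ c * M := mul_nonneg (by linarith) hM
  have hN : (c * M + a) ^ 2 ≤ (g + a) ^ 2 := by gcongr
  have haβ : a * β ≤ c * c * M := by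
    nlinarith [mul_le_mul_of_nonneg_left hcβ hcM, mul_le_mul_of_nonneg_right hcβ ha0,
      mul_le_mul_of_nonneg_left ha (by linarith : 0 ≤ c)]
  have hconc : a * M * (β + c) ^ 2 ≤ β * (c * M + a) ^ 2 := by
    nlinarith [mul_nonneg (sub_nonneg.2 ha) (sub_nonneg.2 haβ)]
  have hsq : 0.9025 ≤ (β + c) ^ 2 := by nlinarith
  have haM : 0 ≤ a * M := mul_nonneg ha0 hM
  nlinarith [mul_le_mul_of_nonneg_left hsq haM, mul_le_mul_of_nonneg_left hN hβ0.le]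

/-- per-subset version of Lemma 2. Assuming `β ≤ 0.4` and
Conditions 1-3, for any `B' ⊆ B` with `|B' ∩ BG| ≥ (1 - β/6)|BG|`, any
`S ⊆ [k]`, and `ψ(B', S) = t·κ_G` (`t ≥ 0`),
`|p̄_{B'}(S) - p(S)| ≤ (5 + √(2.1 t))·β·√(ln(6e/β)/n)`. -/
theorem corruption_and_subset_deviation {k n m : ℕ} (β : ℝ) (hβ0 : 0 < β)
    (hβ : β ≤ 0.4)
    (X : Fin m → Fin n → Fin k) (p : Fin k → ℝ)
    (hp0 : ∀ i, 0 ≤ p i) (hp1 : ∑ i, p i = 1)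
    (BG : Finset (Fin m)) (hBG : (1 - β) * (m : ℝ) ≤ (BG.card : ℝ))
    (hBA : ((Finset.univ \ BG).card : ℝ) ≤ β * (m : ℝ))
    (h1 : Cond1 X p) (h2 : Cond2 β X p BG) (h3 : Cond3 β X BG)
    (B' : Finset (Fin m))
    (hB' : (1 - β / 6) * (BG.card : ℝ) ≤ ((B' ∩ BG).card : ℝ))
    (S : Finset (Fin k))
    (t : ℝ) (ht : 0 ≤ t) (hpsi : psi β X B' S = t * kappaG β m n) :
    |pbar X B' S - probS p S| ≤
      (5 + Real.sqrt (2.1 * t)) * β *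
        Real.sqrt (Real.log (6 * Real.exp 1 / β) / (n : ℝ)) := by
  rcases Nat.eq_zero_or_pos m with rfl | hm
  · have hpbar : ∀ B : Finset (Fin 0), pbar X B S = 0 := fun B => by
      simp [pbar, Finset.eq_empty_of_isEmpty B]
    have h := (h2 S BG subset_rfl (by simp [Finset.eq_empty_of_isEmpty BG])).1
    rw [hpbar] at h ⊢
    refine h.trans ?_
    gcongr
    nlinarith [Real.sqrt_nonneg (2.1 * t)]
  have hM : (0 : ℝ) < m := by exact_mod_cast hm
  set s := Real.sqrt (Real.log (6 * Real.exp 1 / β) / (n : ℝ)) with hs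
  have hs0 : 0 ≤ s := Real.sqrt_nonneg _
  have hlog : 0 ≤ Real.log (6 * Real.exp 1 / β) :=
    (Real.log_nonneg (by norm_num)).trans (log_six_le_log_div hβ0 (by linarith))
  have hκ : kappaG β m n = β * m * s ^ 2 := by
    rw [hs, Real.sq_sqrt (by positivity), kappaG, mul_div_assoc]
  set G := B' ∩ BG
  set A := B' \ BG
  have hsum : ∀ f : Fin m → ℝ, ∑ b ∈ B', f b = ∑ b ∈ G, f b + ∑ b ∈ A, f b := fun f =>
    (Finset.sum_inter_add_sum_sdiff B' BG f).symm
  have hNcard : (B'.card : ℝ) = G.card + A.card := by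
    exact_mod_cast (Finset.card_inter_add_card_sdiff B' BG).symm
  have ha : (A.card : ℝ) ≤ β * m := by
    refine le_trans ?_ hBA
    exact_mod_cast Finset.card_le_card
      (Finset.sdiff_subset_sdiff (Finset.subset_univ B') subset_rfl)
  have hg : (1 - β / 6) * (1 - β) * m ≤ (G.card : ℝ) := by
    refine le_trans ?_ hB'
    rw [mul_assoc]
    exact mul_le_mul_of_nonneg_left hBG (by linarith)
  have hg0 : (0 : ℝ) < G.card :=
    (mul_pos (mul_pos (by linarith) (by linarith)) hM).trans_le hg
  have ha0 : (0 : ℝ) ≤ A.card := by positivity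
  have hN : (0 : ℝ) < B'.card := by linarith
  have hgood : |∑ b ∈ G, (emp X b S - probS p S)| ≤ G.card * (β / 2 * s) := by
    have h := (h2 S G Finset.inter_subset_right hB').1
    have heq : ∑ b ∈ G, (emp X b S - probS p S) = G.card * (pbar X G S - probS p S) := by
      rw [Finset.sum_sub_distrib, Finset.sum_const, nsmul_eq_mul, pbar]
      field_simp
    rw [heq, abs_mul, Nat.abs_cast]
    gcongr
  have hbad := abs_sum_emp_sub_le hβ0 (by linarith) X p h1 A S
  have hroot : ∑ b ∈ A, Real.sqrt (score β X b S) ≤ Real.sqrt (2.1 * t) * β * s * B'.card := by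
    refine abs_le_of_sq_le_sq' ?_ (by positivity) |>.2
    refine (sum_sqrt_score_sq_le β X B' A Finset.sdiff_subset S).trans ?_
    have hsq : Real.sqrt (2.1 * t) ^ 2 = 2.1 * t := Real.sq_sqrt (by positivity)
    calc (A.card : ℝ) * psi β X B' S = t * β * s ^ 2 * (A.card * m) := by
          rw [hpsi, hκ]; ring
      _ ≤ t * β * s ^ 2 * (2.1 * β * (G.card + A.card) ^ 2) := by
          exact mul_le_mul_of_nonneg_left (bad_card_mul_le hβ0 hβ hM.le ha0 ha hg)
            (by positivity)
      _ = _ := by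
          rw [hNcard, mul_pow, mul_pow, mul_pow, hsq]; ring
  have hlin := mul_le_mul_of_nonneg_right
    (good_card_linear_bound hβ0 hβ hM.le ha hg) hs0
  have hdev : pbar X B' S - probS p S = (∑ b ∈ B', (emp X b S - probS p S)) / B'.card := by
    rw [Finset.sum_sub_distrib, Finset.sum_const, nsmul_eq_mul, pbar]
    field_simp
  rw [hdev, abs_div, Nat.abs_cast, div_le_iff₀ hN, hsum]
  refine (abs_add_le _ _).trans ?_
  rw [← hNcard] at hlin
  linarith
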